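/- arXiv:1803.04138 — 8 statements merged into one kernel-verified Lean document; each statement's English description precedes it below -/
import Mathlib

section
/- Let n ≥ 1 and let f be a simple aggregation function on n agents. Then φ_i(f) ≥ 0 for every agent i ∈ {1,...,n}. -/
open MeasureTheory

noncomputable section

/-- The unit cube `[0,1]^n`. -/
def cube (n : ℕ) : Set (Fin n → ℝ) := Set.Icc 0 1

/-- A simple aggregation function on `n` agents: a map `[0,1]^n → [0,1]` that is
surjective (onto `[0,1]`), continuous, and weakly monotonic increasing. -/
def IsSimpleAgg (n : ℕ) (f : (Fin n → ℝ) → ℝ) : Prop :=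
  (∀ x ∈ cube n, f x ∈ Set.Icc (0:ℝ) 1) ∧
  (∀ y ∈ Set.Icc (0:ℝ) 1, ∃ x ∈ cube n, f x = y) ∧
  ContinuousOn f (cube n) ∧
  (∀ x ∈ cube n, ∀ y ∈ cube n, x ≤ y → f x ≤ f y)

/-- The vector `(x_{π<i}, c_{π≥i})`: coordinate `j` equals `x j` if `π j < π i`
and `c` otherwise. -/
def vecLT (n : ℕ) (π : Equiv.Perm (Fin n)) (i : Fin n) (x : Fin n → ℝ) (c : ℝ) :
    Fin n → ℝ := fun j => if π j < π i then x j else c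

/-- The vector `(x_{π≤i}, c_{π>i})`: coordinate `j` equals `x j` if `π j ≤ π i`
and `c` otherwise. -/
def vecLE (n : ℕ) (π : Equiv.Perm (Fin n)) (i : Fin n) (x : Fin n → ℝ) (c : ℝ) :
    Fin n → ℝ := fun j => if π j ≤ π i then x j else c

/-- The importance measure `φ` generalizing the Shapley-Shubik index. -/
def phi (n : ℕ) (f : (Fin n → ℝ) → ℝ) (i : Fin n) : ℝ :=
  (1 / (n.factorial : ℝ)) * ∑ π : Equiv.Perm (Fin n),
    ∫ x in cube n,
      ((f (vecLT n π i x 1) - f (vecLT n π i x 0)) -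
        (f (vecLE n π i x 1) - f (vecLE n π i x 0)))

theorem vecLT_mem_cube {n : ℕ} (π : Equiv.Perm (Fin n)) (i : Fin n) {x : Fin n → ℝ}
    (hx : x ∈ cube n) {c : ℝ} (hc : c ∈ Set.Icc (0 : ℝ) 1) : vecLT n π i x c ∈ cube n := by
  refine ⟨fun j => ?_, fun j => ?_⟩ <;> simp only [vecLT] <;> split_ifs
  exacts [hx.1 j, hc.1, hx.2 j, hc.2]

theorem vecLE_mem_cube {n : ℕ} (π : Equiv.Perm (Fin n)) (i : Fin n) {x : Fin n → ℝ}
    (hx : x ∈ cube n) {c : ℝ} (hc : c ∈ Set.Icc (0 : ℝ) 1) : vecLE n π i x c ∈ cube n := by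
  refine ⟨fun j => ?_, fun j => ?_⟩ <;> simp only [vecLE] <;> split_ifs
  exacts [hx.1 j, hc.1, hx.2 j, hc.2]

theorem vecLE_one_le_vecLT_one {n : ℕ} (π : Equiv.Perm (Fin n)) (i : Fin n) {x : Fin n → ℝ}
    (hx : x ∈ cube n) : vecLE n π i x 1 ≤ vecLT n π i x 1 := by
  intro j
  simp only [vecLE, vecLT]
  split_ifs with h₁ h₂ h₂
  · exact le_rfl
  · exact hx.2 j
  · exact absurd h₂.le h₁
  · exact le_rfl

theorem vecLT_zero_le_vecLE_zero {n : ℕ} (π : Equiv.Perm (Fin n)) (i : Fin n) {x : Fin n → ℝ}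
    (hx : x ∈ cube n) : vecLT n π i x 0 ≤ vecLE n π i x 0 := by
  intro j
  simp only [vecLE, vecLT]
  split_ifs with h₁ h₂ h₂
  · exact le_rfl
  · exact absurd h₁.le h₂
  · exact hx.1 j
  · exact le_rfl

theorem phi_nonneg (n : ℕ) (hn : 1 ≤ n) (f : (Fin n → ℝ) → ℝ)
    (hf : IsSimpleAgg n f) (i : Fin n) :
    0 ≤ phi n f i := by
  obtain ⟨-, -, -, hmono⟩ := hf
  have h0 : (0 : ℝ) ∈ Set.Icc (0 : ℝ) 1 := Set.left_mem_Icc.2 zero_le_one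
  have h1 : (1 : ℝ) ∈ Set.Icc (0 : ℝ) 1 := Set.right_mem_Icc.2 zero_le_one
  refine mul_nonneg (by positivity) (Finset.sum_nonneg fun π _ => ?_)
  refine setIntegral_nonneg measurableSet_Icc fun x hx => ?_
  have hone := hmono _ (vecLE_mem_cube π i hx h1) _ (vecLT_mem_cube π i hx h1)
    (vecLE_one_le_vecLT_one π i hx)
  have hzero := hmono _ (vecLT_mem_cube π i hx h0) _ (vecLE_mem_cube π i hx h0)
    (vecLT_zero_le_vecLE_zero π i hx)
  linarith
end
end

section
/- Let n ≥ 1 and let f be a simple aggregation function on n agents. Then φ is efficient: Σ_{i=1}^n φ_i(f) = 1. -/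
open MeasureTheory

noncomputable section

/-- The vector whose coordinates ranked below `k` by `π` come from `x`, the others being `c`. -/
def prefixVec (n : ℕ) (π : Equiv.Perm (Fin n)) (k : ℕ) (x : Fin n → ℝ) (c : ℝ) : Fin n → ℝ :=
  fun j => if (π j : ℕ) < k then x j else c

theorem vecLT_eq_prefixVec (n : ℕ) (π : Equiv.Perm (Fin n)) (i : Fin n) :
    vecLT n π i = prefixVec n π (π i) := rfl

theorem vecLE_eq_prefixVec (n : ℕ) (π : Equiv.Perm (Fin n)) (i : Fin n) :
    vecLE n π i = prefixVec n π (π i + 1) := by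
  ext x c j
  simp only [vecLE, prefixVec, Fin.le_def, Nat.lt_succ_iff]

theorem prefixVec_zero (n : ℕ) (π : Equiv.Perm (Fin n)) (x : Fin n → ℝ) (c : ℝ) :
    prefixVec n π 0 x c = fun _ => c := by
  ext j
  simp [prefixVec]

theorem prefixVec_self (n : ℕ) (π : Equiv.Perm (Fin n)) (x : Fin n → ℝ) (c : ℝ) :
    prefixVec n π n x c = x := by
  ext j
  simp [prefixVec]

theorem prefixVec_mem_cube {n : ℕ} (π : Equiv.Perm (Fin n)) (k : ℕ) {x : Fin n → ℝ} {c : ℝ}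
    (hx : x ∈ cube n) (hc : c ∈ Set.Icc (0 : ℝ) 1) : prefixVec n π k x c ∈ cube n := by
  refine ⟨fun j => ?_, fun j => ?_⟩ <;> simp only [prefixVec] <;> split_ifs
  exacts [hx.1 j, hc.1, hx.2 j, hc.2]

theorem continuous_prefixVec (n : ℕ) (π : Equiv.Perm (Fin n)) (k : ℕ) (c : ℝ) :
    Continuous fun x => prefixVec n π k x c := by
  refine continuous_pi fun j => ?_
  simp only [prefixVec]
  split_ifs <;> fun_prop

theorem integrableOn_comp_prefixVec {n : ℕ} {f : (Fin n → ℝ) → ℝ} (hf : ContinuousOn f (cube n))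
    (π : Equiv.Perm (Fin n)) (k : ℕ) {c : ℝ} (hc : c ∈ Set.Icc (0 : ℝ) 1) :
    IntegrableOn (fun x => f (prefixVec n π k x c)) (cube n) :=
  (hf.comp (continuous_prefixVec n π k c).continuousOn
    fun _ hx => prefixVec_mem_cube π k hx hc).integrableOn_compact isCompact_Icc

theorem volume_real_cube (n : ℕ) : volume.real (cube n) = 1 := by
  simp [cube, Measure.real, Real.volume_Icc_pi]

theorem IsSimpleAgg.apply_one {n : ℕ} {f : (Fin n → ℝ) → ℝ} (hf : IsSimpleAgg n f) :
    f (fun _ => 1) = 1 := by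
  have h1 : (fun _ => 1) ∈ cube n := ⟨fun _ => zero_le_one, le_rfl⟩
  obtain ⟨x, hx, hfx⟩ := hf.2.1 1 (by simp)
  exact le_antisymm (hf.1 _ h1).2 (hfx.ge.trans (hf.2.2.2 x hx _ h1 hx.2))

theorem IsSimpleAgg.apply_zero {n : ℕ} {f : (Fin n → ℝ) → ℝ} (hf : IsSimpleAgg n f) :
    f (fun _ => 0) = 0 := by
  have h0 : (fun _ => 0) ∈ cube n := ⟨le_rfl, fun _ => zero_le_one⟩
  obtain ⟨x, hx, hfx⟩ := hf.2.1 0 (by simp)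
  exact le_antisymm ((hf.2.2.2 _ h0 x hx hx.1).trans hfx.le) (hf.1 _ h0).1

/-- For a fixed order of the agents, the drops in the range of outcomes telescope to `1`. -/
theorem IsSimpleAgg.sum_range_drop {n : ℕ} {f : (Fin n → ℝ) → ℝ} (hf : IsSimpleAgg n f)
    (π : Equiv.Perm (Fin n)) (x : Fin n → ℝ) :
    ∑ i : Fin n, ((f (vecLT n π i x 1) - f (vecLT n π i x 0)) -
      (f (vecLE n π i x 1) - f (vecLE n π i x 0))) = 1 := by
  set g : ℕ → ℝ := fun k => f (prefixVec n π k x 1) - f (prefixVec n π k x 0) with hg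
  simp only [vecLT_eq_prefixVec, vecLE_eq_prefixVec]
  calc ∑ i : Fin n, (g (π i) - g (π i + 1))
      = ∑ i : Fin n, (g i - g (i + 1)) :=
        Equiv.sum_comp π fun i : Fin n => g i - g (i + 1)
    _ = ∑ k ∈ Finset.range n, (g k - g (k + 1)) :=
        Fin.sum_univ_eq_sum_range (fun k => g k - g (k + 1)) n
    _ = g 0 - g n := Finset.sum_range_sub' g n
    _ = 1 := by simp [hg, prefixVec_zero, prefixVec_self, hf.apply_one, hf.apply_zero]

theorem phi_efficient (n : ℕ) (hn : 1 ≤ n) (f : (Fin n → ℝ) → ℝ)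
    (hf : IsSimpleAgg n f) :
    ∑ i : Fin n, phi n f i = 1 := by
  have hint (π : Equiv.Perm (Fin n)) (i : Fin n) : IntegrableOn
      (fun x => (f (vecLT n π i x 1) - f (vecLT n π i x 0)) -
        (f (vecLE n π i x 1) - f (vecLE n π i x 0))) (cube n) := by
    rw [vecLT_eq_prefixVec, vecLE_eq_prefixVec]
    have h (k : ℕ) : IntegrableOn
        (fun x => f (prefixVec n π k x 1) - f (prefixVec n π k x 0)) (cube n) :=
      (integrableOn_comp_prefixVec hf.2.2.1 π k (by simp)).sub
        (integrableOn_comp_prefixVec hf.2.2.1 π k (by simp))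
    exact (h _).sub (h _)
  simp only [phi]
  rw [← Finset.mul_sum, Finset.sum_comm]
  simp_rw [← integral_finsetSum Finset.univ fun i _ => hint _ i, hf.sum_range_drop]
  simp [volume_real_cube, Fintype.card_perm, Nat.factorial_ne_zero]
end
end

section
/- Let n ≥ 1, let f be a simple aggregation function on n agents, and let i, j ∈ {1,...,n} be symmetric agents in f. Then φ_i(f) = φ_j(f). -/
open MeasureTheory

noncomputable section

theorem comp_swap_mem_cube {n : ℕ} {i j : Fin n} {x : Fin n → ℝ} :
    x ∘ Equiv.swap i j ∈ cube n ↔ x ∈ cube n := by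
  have key : ∀ y : Fin n → ℝ, y ∈ cube n → y ∘ Equiv.swap i j ∈ cube n :=
    fun y hy => ⟨fun k => hy.1 (Equiv.swap i j k), fun k => hy.2 (Equiv.swap i j k)⟩
  refine ⟨fun h => ?_, key x⟩
  have h' := key _ h
  rwa [Function.comp_assoc, ← Equiv.coe_trans, Equiv.swap_swap, Equiv.coe_refl,
    Function.comp_id] at h'

theorem vecLT_mul_swap {n : ℕ} (π : Equiv.Perm (Fin n)) (i j : Fin n) (x : Fin n → ℝ) (c : ℝ) :
    vecLT n (π * Equiv.swap i j) j (x ∘ Equiv.swap i j) c =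
      vecLT n π i x c ∘ Equiv.swap i j := by
  ext k
  simp [vecLT]

theorem vecLE_mul_swap {n : ℕ} (π : Equiv.Perm (Fin n)) (i j : Fin n) (x : Fin n → ℝ) (c : ℝ) :
    vecLE n (π * Equiv.swap i j) j (x ∘ Equiv.swap i j) c =
      vecLE n π i x c ∘ Equiv.swap i j := by
  ext k
  simp [vecLE]

theorem setIntegral_cube_comp_swap {n : ℕ} (i j : Fin n) (g : (Fin n → ℝ) → ℝ) :
    ∫ x in cube n, g (x ∘ Equiv.swap i j) = ∫ x in cube n, g x := by
  have h := (volume_measurePreserving_piCongrLeft (fun _ : Fin n => ℝ)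
    (Equiv.swap i j)).setIntegral_preimage_emb (MeasurableEquiv.measurableEmbedding _) g (cube n)
  have he : ⇑(MeasurableEquiv.piCongrLeft (fun _ : Fin n => ℝ) (Equiv.swap i j)) =
      fun x => x ∘ Equiv.swap i j := by
    ext x k
    obtain ⟨m, rfl⟩ := (Equiv.swap i j).surjective k
    rw [MeasurableEquiv.coe_piCongrLeft, Equiv.piCongrLeft_apply_apply]
    simp
  rw [he] at h
  have hs : (fun x : Fin n → ℝ => x ∘ Equiv.swap i j) ⁻¹' cube n = cube n :=
    Set.ext fun x => comp_swap_mem_cube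
  rwa [hs] at h

theorem phi_symmetric (n : ℕ) (hn : 1 ≤ n) (f : (Fin n → ℝ) → ℝ)
    (hf : IsSimpleAgg n f) (i j : Fin n)
    (hsym : ∀ x ∈ cube n, f (x ∘ Equiv.swap i j) = f x) :
    phi n f i = phi n f j := by
  unfold phi
  congr 1
  refine Fintype.sum_equiv (Equiv.mulRight (Equiv.swap i j)) _ _ fun π => ?_
  rw [Equiv.coe_mulRight]
  refine Eq.trans ?_ (setIntegral_cube_comp_swap i j _)
  refine setIntegral_congr_fun measurableSet_Icc fun x hx => ?_
  have h0 : (0 : ℝ) ∈ Set.Icc (0 : ℝ) 1 := by simp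
  have h1 : (1 : ℝ) ∈ Set.Icc (0 : ℝ) 1 := by simp
  simp only [vecLT_mul_swap, vecLE_mul_swap, hsym _ (vecLT_mem_cube π i hx h0),
    hsym _ (vecLT_mem_cube π i hx h1), hsym _ (vecLE_mem_cube π i hx h0),
    hsym _ (vecLE_mem_cube π i hx h1)]
end
end

section
/- Let n ≥ 1 and let f and g be simple aggregation functions on n agents. Then φ satisfies the transfer axiom: φ_i(f) + φ_i(g) = φ_i(f ∨ g) + φ_i(f ∧ g) for every agent i ∈ {1,...,n}, where (f ∨ g)(x) = max{f(x), g(x)} and (f ∧ g)(x) = min{f(x), g(x)}. -/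
open MeasureTheory

noncomputable section

theorem continuousOn_comp_vecLT {n : ℕ} {f : (Fin n → ℝ) → ℝ} (hf : ContinuousOn f (cube n))
    (π : Equiv.Perm (Fin n)) (i : Fin n) {c : ℝ} (hc : c ∈ Set.Icc (0 : ℝ) 1) :
    ContinuousOn (fun x => f (vecLT n π i x c)) (cube n) := by
  refine hf.comp (Continuous.continuousOn ?_) ?_
  · refine continuous_pi fun j => ?_
    by_cases h : π j < π i <;> simp only [vecLT, h, if_true, if_false] <;> fun_prop
  · refine fun x hx => ⟨fun j => ?_, fun j => ?_⟩ <;> simp only [vecLT] <;> split_ifs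
    exacts [hx.1 j, hc.1, hx.2 j, hc.2]

theorem continuousOn_comp_vecLE {n : ℕ} {f : (Fin n → ℝ) → ℝ} (hf : ContinuousOn f (cube n))
    (π : Equiv.Perm (Fin n)) (i : Fin n) {c : ℝ} (hc : c ∈ Set.Icc (0 : ℝ) 1) :
    ContinuousOn (fun x => f (vecLE n π i x c)) (cube n) := by
  refine hf.comp (Continuous.continuousOn ?_) ?_
  · refine continuous_pi fun j => ?_
    by_cases h : π j ≤ π i <;> simp only [vecLE, h, if_true, if_false] <;> fun_prop
  · refine fun x hx => ⟨fun j => ?_, fun j => ?_⟩ <;> simp only [vecLE] <;> split_ifs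
    exacts [hx.1 j, hc.1, hx.2 j, hc.2]

/-- The integrand of `phi` is integrable when `f` is continuous on the cube. -/
theorem integrableOn_phi_integrand {n : ℕ} {f : (Fin n → ℝ) → ℝ} (hf : ContinuousOn f (cube n))
    (π : Equiv.Perm (Fin n)) (i : Fin n) :
    IntegrableOn (fun x => (f (vecLT n π i x 1) - f (vecLT n π i x 0)) -
      (f (vecLE n π i x 1) - f (vecLE n π i x 0))) (cube n) := by
  have h0 : (0 : ℝ) ∈ Set.Icc (0 : ℝ) 1 := by simp
  have h1 : (1 : ℝ) ∈ Set.Icc (0 : ℝ) 1 := by simp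
  exact (((continuousOn_comp_vecLT hf π i h1).sub (continuousOn_comp_vecLT hf π i h0)).sub
    ((continuousOn_comp_vecLE hf π i h1).sub
      (continuousOn_comp_vecLE hf π i h0))).integrableOn_compact isCompact_Icc

/-- `phi` is additive on functions continuous on the cube. -/
theorem phi_add {n : ℕ} {f g : (Fin n → ℝ) → ℝ} (hf : ContinuousOn f (cube n))
    (hg : ContinuousOn g (cube n)) (i : Fin n) :
    phi n (fun x => f x + g x) i = phi n f i + phi n g i := by
  simp only [phi]
  rw [← mul_add, ← Finset.sum_add_distrib]
  congr 1
  refine Finset.sum_congr rfl fun π _ => ?_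
  rw [← integral_add (integrableOn_phi_integrand hf π i) (integrableOn_phi_integrand hg π i)]
  congr 1
  funext x
  ring

theorem phi_transfer (n : ℕ) (hn : 1 ≤ n) (f g : (Fin n → ℝ) → ℝ)
    (hf : IsSimpleAgg n f) (hg : IsSimpleAgg n g) (i : Fin n) :
    phi n f i + phi n g i =
      phi n (fun x => max (f x) (g x)) i + phi n (fun x => min (f x) (g x)) i := by
  have hmax : ContinuousOn (fun x => max (f x) (g x)) (cube n) := hf.2.2.1.sup hg.2.2.1
  have hmin : ContinuousOn (fun x => min (f x) (g x)) (cube n) := hf.2.2.1.inf hg.2.2.1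
  rw [← phi_add hf.2.2.1 hg.2.2.1, ← phi_add hmax hmin]
  simp only [max_add_min]
end
end

section
/- Let n ≥ 2 and let f be a simple aggregation function on n agents. Then Σ_{j=1}^n ψ̃_j(f) > 0; in particular there exists an agent i with ψ̃_i(f) > 0, so the normalization ψ_i(f) = ψ̃_i(f) / Σ_{j=1}^n ψ̃_j(f) is well defined and Σ_{i=1}^n ψ_i(f) = 1. -/
open MeasureTheory

noncomputable section

/-- The absolute importance measure `ψ̃` generalizing the Penrose-Banzhaf index. -/
def psiTilde (n : ℕ) (f : (Fin n → ℝ) → ℝ) (i : Fin n) : ℝ :=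
  ∫ x in cube n, (f (Function.update x i 1) - f (Function.update x i 0))

lemma isCompact_cube (n : ℕ) : IsCompact (cube n) := isCompact_Icc

lemma cube_subset_closure_interior (n : ℕ) : cube n ⊆ closure (interior (cube n)) := by
  have h : cube n = Set.pi Set.univ fun _ : Fin n => Set.Icc (0 : ℝ) 1 :=
    (Set.pi_univ_Icc (0 : Fin n → ℝ) 1).symm
  rw [h, interior_pi_set Set.finite_univ, closure_pi_set]
  simp [interior_Icc, closure_Ioo]

lemma update_mem_cube {n : ℕ} {x : Fin n → ℝ} (hx : x ∈ cube n) (i : Fin n) {c : ℝ}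
    (hc : c ∈ Set.Icc (0 : ℝ) 1) : Function.update x i c ∈ cube n := by
  refine ⟨fun j => ?_, fun j => ?_⟩ <;> rcases eq_or_ne j i with rfl | hj
  · simpa using hc.1
  · simpa [hj] using hx.1 j
  · simpa using hc.2
  · simpa [hj] using hx.2 j

namespace IsSimpleAgg

variable {n : ℕ} {f : (Fin n → ℝ) → ℝ}

lemma map_zero_eq (hf : IsSimpleAgg n f) : f 0 = 0 := by
  obtain ⟨hr, hs, -, hm⟩ := hf
  have h0 : (0 : Fin n → ℝ) ∈ cube n := ⟨le_rfl, zero_le_one⟩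
  obtain ⟨x, hx, hfx⟩ := hs 0 ⟨le_rfl, zero_le_one⟩
  exact le_antisymm (hfx ▸ hm 0 h0 x hx hx.1) (hr 0 h0).1

lemma map_one_eq (hf : IsSimpleAgg n f) : f 1 = 1 := by
  obtain ⟨hr, hs, -, hm⟩ := hf
  have h1 : (1 : Fin n → ℝ) ∈ cube n := ⟨zero_le_one, le_rfl⟩
  obtain ⟨x, hx, hfx⟩ := hs 1 ⟨zero_le_one, le_rfl⟩
  exact le_antisymm (hr 1 h1).2 (hfx ▸ hm x hx 1 h1 hx.2)

lemma continuousOn_update_sub (hf : IsSimpleAgg n f) (i : Fin n) :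
    ContinuousOn (fun x => f (Function.update x i 1) - f (Function.update x i 0)) (cube n) := by
  have key : ∀ c ∈ Set.Icc (0 : ℝ) 1, ContinuousOn (fun x => f (Function.update x i c)) (cube n) :=
    fun c hc => hf.2.2.1.comp (continuous_id.update i continuous_const).continuousOn
      fun x hx => update_mem_cube hx i hc
  exact (key 1 (by simp)).sub (key 0 (by simp))

lemma update_sub_nonneg (hf : IsSimpleAgg n f) (i : Fin n) {x : Fin n → ℝ} (hx : x ∈ cube n) :
    0 ≤ f (Function.update x i 1) - f (Function.update x i 0) :=
  sub_nonneg.2 <| hf.2.2.2 _ (update_mem_cube hx i (by simp)) _ (update_mem_cube hx i (by simp))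
    (update_le_update_iff.2 ⟨zero_le_one, fun _ _ => le_rfl⟩)

lemma psiTilde_nonneg (hf : IsSimpleAgg n f) (i : Fin n) : 0 ≤ psiTilde n f i :=
  setIntegral_nonneg (isCompact_cube n).measurableSet fun _ hx => hf.update_sub_nonneg i hx

/-- An agent of zero absolute importance is a dummy: moving it from `0` to `1` never changes
the output. -/
lemma update_eq_of_psiTilde_eq_zero (hf : IsSimpleAgg n f) {i : Fin n} (h : psiTilde n f i = 0)
    {x : Fin n → ℝ} (hx : x ∈ cube n) :
    f (Function.update x i 1) = f (Function.update x i 0) := by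
  have hc := hf.continuousOn_update_sub i
  have hae := (setIntegral_eq_zero_iff_of_nonneg_ae
    (ae_restrict_of_forall_mem (isCompact_cube n).measurableSet
      fun _ hx => hf.update_sub_nonneg i hx)
    (hc.integrableOn_compact (μ := volume) (isCompact_cube n))).1 h
  exact sub_eq_zero.1 <|
    Measure.eqOn_of_ae_eq hae hc continuousOn_const (cube_subset_closure_interior n) hx

lemma exists_psiTilde_pos (hf : IsSimpleAgg n f) : ∃ i : Fin n, 0 < psiTilde n f i := by
  by_contra! hle
  have key : ∀ s : Finset (Fin n), f (s.piecewise 1 0) = 0 := by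
    intro s
    induction s using Finset.induction_on with
    | empty => simpa using hf.map_zero_eq
    | insert i s hi ih =>
      have hx : s.piecewise (1 : Fin n → ℝ) 0 ∈ cube n :=
        ⟨Finset.le_piecewise_of_le_of_le s zero_le_one le_rfl,
          Finset.piecewise_le_of_le_of_le s le_rfl zero_le_one⟩
      have h := hf.update_eq_of_psiTilde_eq_zero
        (le_antisymm (hle i) (hf.psiTilde_nonneg i)) hx
      have h0 : Function.update (s.piecewise (1 : Fin n → ℝ) 0) i 0 = s.piecewise 1 0 := by
        simp [Function.update_eq_self_iff, hi]
      rw [Finset.piecewise_insert, Pi.one_apply, h, h0, ih]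
  have h1 := key Finset.univ
  rw [Finset.piecewise_univ, hf.map_one_eq] at h1
  exact one_ne_zero h1

end IsSimpleAgg

theorem psi_well_defined (n : ℕ) (hn : 2 ≤ n) (f : (Fin n → ℝ) → ℝ)
    (hf : IsSimpleAgg n f) :
    0 < ∑ j : Fin n, psiTilde n f j ∧
      (∃ i : Fin n, 0 < psiTilde n f i) ∧
      ∑ i : Fin n, psiTilde n f i / ∑ j : Fin n, psiTilde n f j = 1 := by
  obtain ⟨i, hi⟩ := hf.exists_psiTilde_pos
  have hpos : 0 < ∑ j : Fin n, psiTilde n f j :=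
    Finset.sum_pos' (fun j _ => hf.psiTilde_nonneg j) ⟨i, Finset.mem_univ i, hi⟩
  exact ⟨hpos, ⟨i, hi⟩, by rw [← Finset.sum_div, div_self hpos.ne']⟩
end
end

section
/- Let n ≥ 1, let w ∈ ℝ_{≥0}^n with Σ_{i=1}^n w_i = 1, and for each i ∈ {1,...,n} let f_i : [0,1] → [0,1] be surjective, continuous, and weakly monotonic increasing. Let f : [0,1]^n → [0,1] be defined by f(x) = Σ_{i=1}^n w_i · f_i(x_i). Then φ_i(f) = w_i for every agent i ∈ {1,...,n}. -/
open MeasureTheory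

noncomputable section

theorem MonotoneOn.map_zero_of_surj {g : ℝ → ℝ} (hg : MonotoneOn g (Set.Icc 0 1))
    (hmap : ∀ t ∈ Set.Icc (0:ℝ) 1, g t ∈ Set.Icc (0:ℝ) 1)
    (hsurj : ∀ y ∈ Set.Icc (0:ℝ) 1, ∃ t ∈ Set.Icc (0:ℝ) 1, g t = y) : g 0 = 0 := by
  obtain ⟨t, ht, hgt⟩ := hsurj 0 (by simp)
  have h0 : (0:ℝ) ∈ Set.Icc (0:ℝ) 1 := by simp
  exact le_antisymm (hgt ▸ hg h0 ht ht.1) (hmap 0 h0).1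

theorem MonotoneOn.map_one_of_surj {g : ℝ → ℝ} (hg : MonotoneOn g (Set.Icc 0 1))
    (hmap : ∀ t ∈ Set.Icc (0:ℝ) 1, g t ∈ Set.Icc (0:ℝ) 1)
    (hsurj : ∀ y ∈ Set.Icc (0:ℝ) 1, ∃ t ∈ Set.Icc (0:ℝ) 1, g t = y) : g 1 = 1 := by
  obtain ⟨t, ht, hgt⟩ := hsurj 1 (by simp)
  have h1 : (1:ℝ) ∈ Set.Icc (0:ℝ) 1 := by simp
  exact le_antisymm (hmap 1 h1).2 (hgt.symm.le.trans (hg ht h1 ht.2))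

theorem weighted_sum_importance_integrand {n : ℕ} {w : Fin n → ℝ} {F : Fin n → ℝ → ℝ}
    (h0 : ∀ j, F j 0 = 0) (h1 : ∀ j, F j 1 = 1) (π : Equiv.Perm (Fin n)) (i : Fin n)
    (x : Fin n → ℝ) :
    ((∑ j, w j * F j (vecLT n π i x 1 j)) - (∑ j, w j * F j (vecLT n π i x 0 j))) -
      ((∑ j, w j * F j (vecLE n π i x 1 j)) - (∑ j, w j * F j (vecLE n π i x 0 j))) = w i := by
  simp only [← Finset.sum_sub_distrib]
  rw [Finset.sum_eq_single i]
  · simp [vecLT, vecLE, h0, h1]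
  · intro j _ hj
    have hne : π j ≠ π i := π.injective.ne hj
    rcases lt_or_gt_of_ne hne with h | h
    · simp [vecLT, vecLE, h, h.le]
    · simp [vecLT, vecLE, h.not_gt, h.not_ge, h0, h1]
  · simp

theorem phi_weighted_sum (n : ℕ) (hn : 1 ≤ n) (w : Fin n → ℝ)
    (hw : ∀ i, 0 ≤ w i) (hw1 : ∑ i, w i = 1) (F : Fin n → ℝ → ℝ)
    (hFmap : ∀ i, ∀ t ∈ Set.Icc (0:ℝ) 1, F i t ∈ Set.Icc (0:ℝ) 1)
    (hFsurj : ∀ i, ∀ y ∈ Set.Icc (0:ℝ) 1, ∃ t ∈ Set.Icc (0:ℝ) 1, F i t = y)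
    (hFcont : ∀ i, ContinuousOn (F i) (Set.Icc (0:ℝ) 1))
    (hFmono : ∀ i, MonotoneOn (F i) (Set.Icc (0:ℝ) 1)) (i : Fin n) :
    phi n (fun x => ∑ j, w j * F j (x j)) i = w i := by
  have h0 j : F j 0 = 0 := (hFmono j).map_zero_of_surj (hFmap j) (hFsurj j)
  have h1 j : F j 1 = 1 := (hFmono j).map_one_of_surj (hFmap j) (hFsurj j)
  simp only [phi, weighted_sum_importance_integrand h0 h1, setIntegral_const, volume_real_cube,
    one_smul, Finset.sum_const, Finset.card_univ, Fintype.card_perm, Fintype.card_fin,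
    nsmul_eq_mul]
  field_simp
end
end

section
/- Let n ≥ 1 and let α_1,...,α_n be positive real numbers. Let f : [0,1]^n → [0,1] be defined by f(x) = Π_{j=1}^n x_j^{α_j} (real powers, with 0^{α_j} = 0), and set Λ = Π_{j=1}^n (α_j + 1). Then for every agent i ∈ N = {1,...,n}, φ_i(f) = (1/(n!·Λ)) · ( (n−1)! + α_i · Σ_{T ⊆ N∖{i}} |T|! · (n−1−|T|)! · Π_{j∈T} (α_j + 1) ), the sum ranging over all subsets T of N∖{i}. -/
open MeasureTheory

noncomputable section

theorem integrableOn_prod_rpow {n : ℕ} {α : Fin n → ℝ} (hα : ∀ j, 0 < α j)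
    (S : Finset (Fin n)) : IntegrableOn (fun x : Fin n → ℝ => ∏ j ∈ S, x j ^ α j) (cube n) := by
  refine ContinuousOn.integrableOn_compact isCompact_Icc (Continuous.continuousOn ?_)
  exact continuous_finsetProd _ fun j _ =>
    (continuous_apply j).rpow_const fun _ => Or.inr (hα j).le

theorem integral_cube_prod_rpow {n : ℕ} {α : Fin n → ℝ} (hα : ∀ j, 0 < α j)
    (S : Finset (Fin n)) :
    ∫ x in cube n, ∏ j ∈ S, x j ^ α j = ∏ j ∈ S, (α j + 1)⁻¹ := by
  have hmeas : (volume : Measure (Fin n → ℝ)).restrict (cube n) =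
      Measure.pi fun _ => (volume : Measure ℝ).restrict (Set.Icc 0 1) := by
    rw [cube, ← Set.pi_univ_Icc, volume_pi, Measure.restrict_pi_pi]
    rfl
  have hprod : ∀ x : Fin n → ℝ,
      ∏ j ∈ S, x j ^ α j = ∏ j, (fun t : ℝ => if j ∈ S then t ^ α j else 1) (x j) := by
    intro x
    simp [Finset.prod_ite_mem]
  simp_rw [hprod]
  rw [hmeas, integral_fintype_prod_eq_prod (𝕜 := ℝ)
    (f := fun j (t : ℝ) => if j ∈ S then t ^ α j else 1)]
  have hfac : ∀ j, (∫ t in Set.Icc (0 : ℝ) 1, if j ∈ S then t ^ α j else 1) =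
      if j ∈ S then (α j + 1)⁻¹ else 1 := by
    intro j
    rw [integral_Icc_eq_integral_Ioc, ← intervalIntegral.integral_of_le zero_le_one]
    split_ifs
    · rw [integral_rpow (Or.inl (by linarith [hα j])), Real.one_rpow,
        Real.zero_rpow (by linarith [hα j]), sub_zero, one_div]
    · simp
  simp_rw [hfac]
  simp [Finset.prod_ite_mem]

/-- The agents placed after `i` by the permutation `π`. -/
def successors {n : ℕ} (i : Fin n) (π : Equiv.Perm (Fin n)) : Finset (Fin n) :=
  {j | π i < π j}

theorem mem_successors {n : ℕ} {i j : Fin n} {π : Equiv.Perm (Fin n)} :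
    j ∈ successors i π ↔ π i < π j := by
  simp [successors]

theorem card_successors {n : ℕ} (i : Fin n) (π : Equiv.Perm (Fin n)) :
    (successors i π).card = n - 1 - π i := by
  rw [← Fin.card_Ioi, ← Finset.card_map π.toEmbedding]
  congr 1
  ext k
  simp [successors]

theorem apply_eq_of_successors_eq {n : ℕ} {i : Fin n} {π σ : Equiv.Perm (Fin n)}
    (h : successors i π = successors i σ) : π i = σ i := by
  have hcard := card_successors i π
  rw [h, card_successors] at hcard
  ext
  omega

/-- The position of an agent relative to `i` when exactly the agents in `T` come after `i`. -/
def rank {n : ℕ} (i : Fin n) (T : Finset (Fin n)) (j : Fin n) : Fin 3 :=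
  if j = i then 1 else if j ∈ T then 2 else 0

theorem exists_successors_eq {n : ℕ} {i : Fin n} {T : Finset (Fin n)} (hT : i ∉ T) :
    ∃ π, successors i π = T := by
  refine ⟨(Tuple.sort (rank i T))⁻¹, ?_⟩
  have hmono := Tuple.monotone_sort (rank i T)
  have hlt : ∀ a b, rank i T a < rank i T b →
      (Tuple.sort (rank i T))⁻¹ a < (Tuple.sort (rank i T))⁻¹ b := by
    intro a b hab
    by_contra! hle
    have := hmono hle
    simp only [Function.comp_apply, Equiv.Perm.inv_def, Equiv.apply_symm_apply] at this
    exact absurd hab this.not_gt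
  ext j
  rw [mem_successors]
  refine ⟨fun h => ?_, fun h => hlt _ _ ?_⟩
  · by_contra hj
    have hji : j ≠ i := by rintro rfl; exact lt_irrefl _ h
    exact lt_asymm h (hlt j i (by simp [rank, hj, hji]))
  · have hji : j ≠ i := by rintro rfl; exact hT h
    simp [rank, h, hji]

theorem rank_comp_eq_iff {n : ℕ} {i : Fin n} {T : Finset (Fin n)} {σ : Equiv.Perm (Fin n)}
    (hσ : successors i σ = T) (g : Equiv.Perm (Fin n)) :
    rank i T ∘ g = rank i T ↔ successors i (σ * g) = T := by
  have hT : i ∉ T := by rw [← hσ, mem_successors]; exact lt_irrefl _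
  constructor
  · intro h
    have hval : ∀ j, rank i T (g j) = rank i T j := congrFun h
    have hgi : g i = i := by
      by_contra hne
      have := hval i
      by_cases hm : g i ∈ T <;> simp [rank, hne, hm] at this
    ext j
    rw [mem_successors, Equiv.Perm.mul_apply, Equiv.Perm.mul_apply, hgi, ← mem_successors, hσ]
    by_cases hji : j = i
    · rw [hji, hgi]
    have hgji : g j ≠ i := fun he => hji (g.injective (he.trans hgi.symm))
    have := hval j
    by_cases h1 : g j ∈ T <;> by_cases h2 : j ∈ T <;> simp_all [rank]
  · intro h
    have hgi : g i = i := σ.injective (apply_eq_of_successors_eq (h.trans hσ.symm))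
    funext j
    have hiff : g j ∈ T ↔ j ∈ T := by
      conv_rhs => rw [← h]
      rw [← hσ, mem_successors, mem_successors, Equiv.Perm.mul_apply, Equiv.Perm.mul_apply, hgi]
    have hieq : g j = i ↔ j = i := by
      conv_lhs => rw [← hgi]
      exact g.injective.eq_iff
    simp [rank, hiff, hieq]

theorem card_filter_successors_eq {n : ℕ} {i : Fin n} {T : Finset (Fin n)} (hT : i ∉ T) :
    (Finset.univ.filter fun π : Equiv.Perm (Fin n) => successors i π = T).card =
      T.card.factorial * (n - 1 - T.card).factorial := by
  obtain ⟨σ, hσ⟩ := exists_successors_eq hT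
  have hcongr : (Finset.univ.filter fun π : Equiv.Perm (Fin n) => successors i π = T).card =
      Fintype.card {g : Equiv.Perm (Fin n) // rank i T ∘ g = rank i T} := by
    rw [← Fintype.card_subtype]
    refine (Fintype.card_congr ((Equiv.mulLeft σ).subtypeEquiv fun g => ?_)).symm
    exact rank_comp_eq_iff hσ g
  have h0 : (Finset.univ.filter fun j => rank i T j = 0) = (insert i T)ᶜ := by
    ext j
    rw [Finset.mem_filter_univ, rank]
    split_ifs <;> simp_all
  have h1 : (Finset.univ.filter fun j => rank i T j = 1) = {i} := by
    ext j
    rw [Finset.mem_filter_univ, rank]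
    split_ifs <;> simp_all
  have h2 : (Finset.univ.filter fun j => rank i T j = 2) = T := by
    ext j
    rw [Finset.mem_filter_univ, rank]
    split_ifs <;> simp_all
  rw [hcongr, DomMulAct.stabilizer_card, Fin.prod_univ_three]
  simp only [Fintype.card_subtype, h0, h1, h2, Finset.card_compl, Finset.card_insert_of_notMem hT,
    Fintype.card_fin, Finset.card_singleton, Nat.factorial_one, mul_one]
  rw [mul_comm, Nat.sub_sub, Nat.add_comm 1]

theorem sum_perm_successors {n : ℕ} (i : Fin n) (F : Finset (Fin n) → ℝ) :
    ∑ π : Equiv.Perm (Fin n), F (successors i π) =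
      ∑ T ∈ (Finset.univ.erase i).powerset,
        (T.card.factorial : ℝ) * ((n - 1 - T.card).factorial : ℝ) * F T := by
  have hmaps : ∀ π ∈ (Finset.univ : Finset (Equiv.Perm (Fin n))),
      successors i π ∈ (Finset.univ.erase i).powerset := by
    intro π _
    rw [Finset.mem_powerset]
    intro j hj
    refine Finset.mem_erase.2 ⟨?_, Finset.mem_univ _⟩
    rintro rfl
    exact lt_irrefl _ (mem_successors.1 hj)
  rw [← Finset.sum_fiberwise_of_maps_to hmaps]
  refine Finset.sum_congr rfl fun T hT => ?_
  have hiT : i ∉ T := fun h => (Finset.mem_erase.1 (Finset.mem_powerset.1 hT h)).1 rfl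
  rw [Finset.sum_congr rfl fun π hπ => by rw [(Finset.mem_filter.1 hπ).2],
    Finset.sum_const, card_filter_successors_eq hiT, nsmul_eq_mul]
  push_cast
  ring

theorem prod_ite_rpow_one {n : ℕ} (α : Fin n → ℝ) (x : Fin n → ℝ) (p : Fin n → Prop)
    [DecidablePred p] :
    ∏ j, (if p j then x j else 1) ^ α j = ∏ j with p j, x j ^ α j := by
  rw [Finset.prod_filter]
  refine Finset.prod_congr rfl fun j _ => ?_
  split_ifs <;> simp

theorem prod_ite_rpow_zero {n : ℕ} {α : Fin n → ℝ} (hα : ∀ j, 0 < α j) (x : Fin n → ℝ)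
    {p : Fin n → Prop} [DecidablePred p] {k : Fin n} (hk : ¬ p k) :
    ∏ j, (if p j then x j else 0) ^ α j = 0 :=
  Finset.prod_eq_zero (Finset.mem_univ k) (by simp [hk, Real.zero_rpow (hα k).ne'])

theorem integral_phi_integrand {n : ℕ} {α : Fin n → ℝ} (hα : ∀ j, 0 < α j) (i : Fin n)
    (π : Equiv.Perm (Fin n)) :
    ∫ x in cube n,
      ((∏ j, vecLT n π i x 1 j ^ α j - ∏ j, vecLT n π i x 0 j ^ α j) -
        (∏ j, vecLE n π i x 1 j ^ α j - ∏ j, vecLE n π i x 0 j ^ α j)) =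
      (∏ j, (α j + 1))⁻¹ *
        ((if successors i π = ∅ then 1 else 0) +
          α i * ∏ j ∈ successors i π, (α j + 1)) := by
  have hpos : ∀ j, α j + 1 ≠ 0 := fun j => by linarith [hα j]
  have hle : (Finset.univ.filter fun j => π j ≤ π i) = (successors i π)ᶜ := by
    ext j
    simp [mem_successors]
  have hlt : (Finset.univ.filter fun j => π j < π i) = (successors i π)ᶜ.erase i := by
    ext j
    rw [Finset.mem_filter_univ, Finset.mem_erase, Finset.mem_compl, mem_successors, not_lt,
      lt_iff_le_and_ne, π.injective.ne_iff, and_comm]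
  have hlast : ∀ x : Fin n → ℝ, ∏ j, vecLE n π i x 0 j ^ α j =
      (if successors i π = ∅ then 1 else 0) * ∏ j, x j ^ α j := by
    intro x
    split_ifs with h
    · rw [one_mul]
      refine Finset.prod_congr rfl fun j _ => ?_
      have hj : π j ≤ π i := not_lt.1 fun hj => by simpa [h] using mem_successors.2 hj
      rw [vecLE, if_pos hj]
    · obtain ⟨k, hk⟩ := Finset.nonempty_iff_ne_empty.2 h
      rw [zero_mul]
      exact prod_ite_rpow_zero hα x (not_le.2 (mem_successors.1 hk))
  have hi : i ∈ (successors i π)ᶜ := by simp [mem_successors]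
  have hcompl : (∏ j ∈ (successors i π)ᶜ, (α j + 1)⁻¹) =
      (∏ j, (α j + 1))⁻¹ * ∏ j ∈ successors i π, (α j + 1) := by
    rw [← Finset.prod_compl_mul_prod (successors i π) fun j => α j + 1, Finset.prod_inv_distrib]
    have := Finset.prod_ne_zero_iff.2 fun j (_ : j ∈ successors i π) => hpos j
    field_simp
  have herase : (∏ j ∈ (successors i π)ᶜ.erase i, (α j + 1)⁻¹) =
      (α i + 1) * ∏ j ∈ (successors i π)ᶜ, (α j + 1)⁻¹ := by
    rw [← Finset.mul_prod_erase _ _ hi, mul_inv_cancel_left₀ (hpos i)]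
  have hintegrand : ∀ x : Fin n → ℝ,
      ((∏ j, vecLT n π i x 1 j ^ α j - ∏ j, vecLT n π i x 0 j ^ α j) -
        (∏ j, vecLE n π i x 1 j ^ α j - ∏ j, vecLE n π i x 0 j ^ α j)) =
      ∏ j ∈ (successors i π)ᶜ.erase i, x j ^ α j - (∏ j ∈ (successors i π)ᶜ, x j ^ α j -
        (if successors i π = ∅ then 1 else 0) * ∏ j, x j ^ α j) := by
    intro x
    rw [hlast]
    simp only [vecLT, vecLE]
    rw [prod_ite_rpow_one, prod_ite_rpow_one, prod_ite_rpow_zero hα x (p := fun j => π j < π i) (lt_irrefl _), hle, hlt,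
      sub_zero]
  simp_rw [hintegrand]
  have hint := integrableOn_prod_rpow hα
  rw [integral_sub (hint _) (Integrable.sub' (hint _) ((hint _).const_mul _)),
    integral_sub (hint _) ((hint _).const_mul _), integral_const_mul,
    integral_cube_prod_rpow hα, integral_cube_prod_rpow hα, integral_cube_prod_rpow hα,
    herase, hcompl, Finset.prod_inv_distrib]
  ring

theorem phi_power_product (n : ℕ) (hn : 1 ≤ n) (α : Fin n → ℝ)
    (hα : ∀ j, 0 < α j) (i : Fin n) :
    phi n (fun x => ∏ j, x j ^ α j) i =
      (1 / ((n.factorial : ℝ) * ∏ j, (α j + 1))) *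
        (((n - 1).factorial : ℝ) +
          α i * ∑ T ∈ (Finset.univ.erase i).powerset,
            (T.card.factorial : ℝ) * ((n - 1 - T.card).factorial : ℝ) *
              ∏ j ∈ T, (α j + 1)) := by
  have hsum := sum_perm_successors i fun T =>
    (∏ j, (α j + 1))⁻¹ * ((if T = ∅ then 1 else 0) + α i * ∏ j ∈ T, (α j + 1))
  have hempty : ∑ T ∈ (Finset.univ.erase i).powerset,
      (T.card.factorial : ℝ) * ((n - 1 - T.card).factorial : ℝ) * (if T = ∅ then 1 else 0) =
      ((n - 1).factorial : ℝ) := by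
    simp
  simp only [phi, integral_phi_integrand hα]
  rw [hsum, ← hempty, Finset.mul_sum _ _ (α i), ← Finset.sum_add_distrib, one_div, one_div,
    mul_inv, mul_assoc, Finset.mul_sum _ _ (∏ j, (α j + 1))⁻¹]
  congr 1
  refine Finset.sum_congr rfl fun T _ => ?_
  ring
end
end

section
/- Let n ≥ 1, let q' ∈ ℝ with q' > 0, and let w' ∈ ℝ_{≥0}^n be such that the weighted game [q'; w'] is constant-sum, i.e., for every subset S ⊆ N = {1,...,n} exactly one of S and N∖S is winning: Σ_{i∈S} w'_i ≥ q' holds if and only if Σ_{i∈N∖S} w'_i < q'. Then there exist a positive integer q and natural-number weights w ∈ ℕ^n with Σ_{i=1}^n w_i = 2q − 1 (in particular the weight sum is odd) such that for every subset S ⊆ N: Σ_{i∈S} w'_i ≥ q' if and only if Σ_{i∈S} w_i ≥ q. -/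
/-- Real multiples of nonnegative weights can be rounded to natural numbers, each within
distance one, so that the total is odd. -/
theorem exists_nat_rounding_odd_sum {ι : Type*} [Fintype ι] [Nonempty ι] (v : ι → ℝ)
    (hv : ∀ i, 0 ≤ v i) :
    ∃ w : ι → ℕ, Odd (∑ i, w i) ∧ ∀ i, |(w i : ℝ) - v i| ≤ 1 := by
  classical
  have floor_le i : (⌊v i⌋₊ : ℝ) ≤ v i := Nat.floor_le (hv i)
  have lt_floor i : v i < ⌊v i⌋₊ + 1 := Nat.lt_floor_add_one _
  obtain ho | he := (Nat.even_or_odd (∑ i, ⌊v i⌋₊)).symm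
  · refine ⟨fun i => ⌊v i⌋₊, ho, fun i => abs_le.2 ⟨?_, ?_⟩⟩ <;>
      linarith [floor_le i, lt_floor i]
  · obtain ⟨j⟩ := ‹Nonempty ι›
    refine ⟨fun i => ⌊v i⌋₊ + if i = j then 1 else 0, ?_, fun i => ?_⟩
    · simpa [Finset.sum_add_distrib] using he.add_one
    · rw [abs_le]
      beta_reduce
      split_ifs <;> push_cast <;> constructor <;> linarith [floor_le i, lt_floor i]

/-- The difference of the weights of a set and its complement moves by at most the number of
elements if every weight moves by at most one. -/
theorem sum_sub_sum_compl_le {ι : Type*} [Fintype ι] [DecidableEq ι] (v w : ι → ℝ)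
    (h : ∀ i, |w i - v i| ≤ 1) (S : Finset ι) :
    (∑ i ∈ S, v i - ∑ i ∈ Sᶜ, v i) - Fintype.card ι ≤ ∑ i ∈ S, w i - ∑ i ∈ Sᶜ, w i := by
  have hS : ∑ i ∈ S, (v i - w i) ≤ ∑ _i ∈ S, (1 : ℝ) :=
    Finset.sum_le_sum fun i _ => by linarith [(abs_le.1 (h i)).1]
  have hSc : ∑ i ∈ Sᶜ, (w i - v i) ≤ ∑ _i ∈ Sᶜ, (1 : ℝ) :=
    Finset.sum_le_sum fun i _ => (abs_le.1 (h i)).2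
  have hcard : ∑ _i ∈ S, (1 : ℝ) + ∑ _i ∈ Sᶜ, (1 : ℝ) = Fintype.card ι := by
    rw [Finset.sum_add_sum_compl]
    simp
  rw [Finset.sum_sub_distrib] at hS hSc
  linarith

/-- For every constant-sum weighted game `[q'; w']` there is an integer
representation `[q; w]` with odd weight sum `2q - 1`. -/
theorem constant_sum_integer_representation (n : ℕ) (hn : 1 ≤ n)
    (q' : ℝ) (hq' : 0 < q') (w' : Fin n → ℝ) (hw' : ∀ i, 0 ≤ w' i)
    (hcs : ∀ S : Finset (Fin n), (q' ≤ ∑ i ∈ S, w' i) ↔ ¬ q' ≤ ∑ i ∈ Sᶜ, w' i) :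
    ∃ (q : ℕ) (w : Fin n → ℕ), 0 < q ∧ (∑ i, w i) = 2 * q - 1 ∧
      ∀ S : Finset (Fin n), (q' ≤ ∑ i ∈ S, w' i) ↔ q ≤ ∑ i ∈ S, w i := by
  have : Nonempty (Fin n) := ⟨⟨0, hn⟩⟩
  have hscale : ∀ᶠ M : ℝ in Filter.atTop, ∀ S : Finset (Fin n), q' ≤ ∑ i ∈ S, w' i →
      (n : ℝ) < M * (∑ i ∈ S, w' i - ∑ i ∈ Sᶜ, w' i) := by
    refine Filter.eventually_all.2 fun S => ?_
    by_cases hS : q' ≤ ∑ i ∈ S, w' i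
    · have hpos : 0 < ∑ i ∈ S, w' i - ∑ i ∈ Sᶜ, w' i := by
        linarith [not_le.1 ((hcs S).1 hS)]
      filter_upwards [(Filter.tendsto_id.atTop_mul_const hpos).eventually_gt_atTop (n : ℝ)]
        with M hM _ using hM
    · exact Filter.Eventually.of_forall fun _ h => absurd h hS
  obtain ⟨M, hM, hM0⟩ := (hscale.and (Filter.eventually_ge_atTop 0)).exists
  obtain ⟨w, ⟨k, hk⟩, hw⟩ :=
    exists_nat_rounding_odd_sum (fun i => M * w' i) fun i => mul_nonneg hM0 (hw' i)
  have hwin (S : Finset (Fin n)) (hS : q' ≤ ∑ i ∈ S, w' i) :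
      ∑ i ∈ Sᶜ, w i < ∑ i ∈ S, w i := by
    have h := sum_sub_sum_compl_le _ (fun i => (w i : ℝ)) hw S
    rw [← Finset.mul_sum, ← Finset.mul_sum, ← mul_sub, Fintype.card_fin] at h
    have hlt : ∑ i ∈ Sᶜ, (w i : ℝ) < ∑ i ∈ S, (w i : ℝ) := by linarith [hM S hS]
    exact_mod_cast hlt
  refine ⟨k + 1, w, k.succ_pos, by omega, fun S => ?_⟩
  have hsum := Finset.sum_add_sum_compl S w
  constructor
  · intro hS
    have := hwin S hS
    omega
  · intro hq
    by_contra hS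
    have := hwin Sᶜ (not_not.1 (mt (hcs S).2 hS))
    rw [compl_compl] at this
    omega
end
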